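/- Let f, g ∈ R[t][∂;'] with deg_∂ f ≤ m, deg_∂ g ≤ n, both of degree at most d ≥ 2 in t, with μ = 2(m+n)d, and let V̂ be the inflated differential Sylvester matrix. Then ‖V̂‖_F² ≤ μ·(d^{2n}‖f‖² + d^{2m}‖g‖²), and hence ‖V̂‖₂² ≤ μ·(d^{2n}‖f‖² + d^{2m}‖g‖²). -/

import Mathlib

open Polynomial

/-- Left multiplication by ∂ in R[t][∂;′]: ∂·(a∂^i) = a∂^(i+1) + a′∂^i. -/
noncomputable def dMulP (g : Polynomial (Polynomial ℝ)) : Polynomial (Polynomial ℝ) :=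
  X * g + g.sum fun i a => C (derivative a) * X ^ i

/-- The skew (Ore) multiplication in R[t][∂;′]. -/
noncomputable def skewMulP (f g : Polynomial (Polynomial ℝ)) : Polynomial (Polynomial ℝ) :=
  f.sum fun i a => C a * dMulP^[i] g


/-- The differential Sylvester matrix of f, g ∈ R[t][∂;′] over R[t]. -/
noncomputable def sylvP (f g : Polynomial (Polynomial ℝ)) (m n : ℕ) :
    Matrix (Fin (m + n)) (Fin (m + n)) (Polynomial ℝ) :=
  Matrix.of fun i j =>
    if (i : ℕ) < n then (dMulP^[(i : ℕ)] f).coeff j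
    else (dMulP^[(i : ℕ) - n] g).coeff j


/-- Squared coefficient 2-norm of p ∈ R[t]. -/
noncomputable def polyNormSq (p : Polynomial ℝ) : ℝ := p.sum fun _ a => a ^ 2

/-- Squared coefficient 2-norm of f ∈ R[t][∂;′]. -/
noncomputable def dNormSq (f : Polynomial (Polynomial ℝ)) : ℝ := f.sum fun _ a => polyNormSq a

namespace InflAux

/-- Rook-type numbers bounding the norm of the i-th power. -/
def B : ℕ → ℕ → ℕ
  | 0, _ => 1
  | i + 1, d => B i d + d * B i (d - 1)

lemma B_pos (i d : ℕ) : 1 ≤ B i d := by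
  induction i with
  | zero => simp [B]
  | succ i ih => simp only [B]; omega

lemma B_mono (i : ℕ) : ∀ d, B i d ≤ B i (d + 1) := by
  induction i with
  | zero => intro d; simp [B]
  | succ i ih =>
    intro d
    simp only [B, Nat.add_sub_cancel]
    rcases d with _ | d
    · have := ih 0
      simp only [Nat.zero_mul, Nat.zero_add] at *
      omega
    · simp only [Nat.add_sub_cancel]
      exact Nat.add_le_add (ih _) (Nat.mul_le_mul (by omega) (ih d))

lemma B_key (i : ℕ) : ∀ d, (d + 2) * B (i + 2) (d + 1) ≤ (d + 1) * B (i + 2) (d + 2) := by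
  induction i with
  | zero =>
    intro d
    simp only [B, Nat.add_sub_cancel, show d + 2 - 1 = d + 1 by omega]
    nlinarith
  | succ i ih =>
    intro d
    have h1 := ih d
    have h2 := B_mono (i + 2) d
    have e1 : B (i + 1 + 2) (d + 1) = B (i + 2) (d + 1) + (d + 1) * B (i + 2) d := by
      rw [show i + 1 + 2 = (i + 2) + 1 by ring, B]; simp
    have e2 : B (i + 1 + 2) (d + 2) = B (i + 2) (d + 2) + (d + 2) * B (i + 2) (d + 1) := by
      rw [show i + 1 + 2 = (i + 2) + 1 by ring, B]; simp
    rw [e1, e2]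
    have h3 := Nat.mul_le_mul_left ((d + 1) * (d + 2)) h2
    nlinarith

lemma B_step (i d : ℕ) (hd : 2 ≤ d) : B (i + 3) d ≤ d * B (i + 2) d := by
  obtain ⟨e, rfl⟩ := Nat.exists_eq_add_of_le' hd
  have h := B_key i e
  rw [show i + 3 = (i + 2) + 1 by ring, B, show e + 2 - 1 = e + 1 by omega]
  nlinarith

lemma B_three (e : ℕ) : B 3 (e + 2) = (e + 2) ^ 3 + 2 * (e + 2) + 1 := by
  rcases e with _ | e
  · rfl
  · simp [B, show e + 1 + 2 - 1 = e + 2 by omega]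
    ring

lemma B_bound (k d : ℕ) (hd : 2 ≤ d) : B (k + 3) d ≤ d ^ k * B 3 d := by
  induction k with
  | zero => simp
  | succ k ih =>
    have := B_step (k + 1) d hd
    rw [show k + 1 + 2 = k + 3 by ring] at this
    calc _ ≤ _ := this
      _ ≤ d * (d ^ k * B 3 d) := Nat.mul_le_mul_left _ ih
      _ = _ := by ring

lemma B_sq (k d : ℕ) (hd : 2 ≤ d) :
    13 * (B (k + 3) d) ^ 2 + 12 * d ^ (2 * (k + 3)) ≤ 12 * d ^ (2 * (k + 4)) := by
  have h1 := Nat.pow_le_pow_left (B_bound k d hd) 2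
  have h2 : 13 * (B 3 d) ^ 2 + 12 * d ^ 6 ≤ 12 * d ^ 8 := by
    obtain ⟨e, rfl⟩ := Nat.exists_eq_add_of_le' hd
    rw [B_three]
    ring_nf
    linarith [Nat.zero_le e, Nat.zero_le (e ^ 2), Nat.zero_le (e ^ 3), Nat.zero_le (e ^ 4), Nat.zero_le (e ^ 5),
      Nat.zero_le (e ^ 6), Nat.zero_le (e ^ 7), Nat.zero_le (e ^ 8)]
  calc _ ≤ 13 * (d ^ k * B 3 d) ^ 2 + 12 * d ^ (2 * (k + 3)) := by omega
    _ = d ^ (2 * k) * (13 * (B 3 d) ^ 2 + 12 * d ^ 6) := by ring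
    _ ≤ d ^ (2 * k) * (12 * d ^ 8) := Nat.mul_le_mul_left _ h2
    _ = _ := by ring

lemma S_three (k d : ℕ) (hd : 2 ≤ d) :
    13 * (∑ i ∈ Finset.range (k + 3), (B i d) ^ 2) ≤ 12 * d ^ (2 * (k + 3)) := by
  induction k with
  | zero =>
    obtain ⟨e, rfl⟩ := Nat.exists_eq_add_of_le' hd
    simp only [Finset.sum_range_succ, Finset.sum_range_zero, B]
    simp
    ring_nf
    linarith [Nat.zero_le e, Nat.zero_le (e ^ 2), Nat.zero_le (e ^ 3), Nat.zero_le (e ^ 4), Nat.zero_le (e ^ 5),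
      Nat.zero_le (e ^ 6), Nat.zero_le (e ^ 7), Nat.zero_le (e ^ 8)]
  | succ k ih =>
    rw [show k + 1 + 3 = (k + 3) + 1 by ring, Finset.sum_range_succ]
    have := B_sq k d hd
    rw [show k + 4 = k + 3 + 1 by ring] at this
    omega

lemma S_bound (n d μ : ℕ) (hd : 2 ≤ d) (hμ : 2 * n * d ≤ μ) :
    (μ + 1) * (∑ i ∈ Finset.range n, (B i d) ^ 2) ≤ μ * d ^ (2 * n) := by
  match n, hμ with
  | 0, _ => simp
  | 1, hμ =>
    simp only [Finset.sum_range_one, B]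
    have h4 : 4 ≤ d ^ (2 * 1) := Nat.pow_le_pow_left hd 2
    have := Nat.mul_le_mul_left μ h4
    omega
  | 2, hμ =>
    simp only [Finset.sum_range_succ, Finset.sum_range_zero, B]
    obtain ⟨e, rfl⟩ := Nat.exists_eq_add_of_le' hd
    have h8 : 8 ≤ μ := by omega
    have : 9 * (1 + (e + 3) ^ 2) ≤ 8 * (e + 2) ^ 4 := by
      ring_nf
      linarith [Nat.zero_le e, Nat.zero_le (e ^ 2), Nat.zero_le (e ^ 3), Nat.zero_le (e ^ 4), Nat.zero_le (e ^ 5),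
      Nat.zero_le (e ^ 6), Nat.zero_le (e ^ 7), Nat.zero_le (e ^ 8)]
    have h9 : 1 + (e + 3) ^ 2 ≤ (e + 2) ^ 4 := by omega
    have h10 := Nat.mul_le_mul_left (μ - 8) h9
    obtain ⟨ν, rfl⟩ := Nat.exists_eq_add_of_le' h8
    simp at h10 ⊢
    nlinarith
  | k + 3, hμ =>
    have h := S_three k d hd
    have h12 : 12 ≤ μ := by nlinarith
    generalize (∑ i ∈ Finset.range (k + 3), (B i d) ^ 2) = S at *
    generalize d ^ (2 * (k + 3)) = T at *
    obtain ⟨ν, rfl⟩ := Nat.exists_eq_add_of_le' h12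
    have h9 : S ≤ T := by omega
    nlinarith [Nat.mul_le_mul_left ν h9]

/-- Coefficientwise derivative. -/
noncomputable def Dm (g : Polynomial (Polynomial ℝ)) : Polynomial (Polynomial ℝ) :=
  g.sum fun i a => C (derivative a) * X ^ i

lemma Dm_coeff (g : Polynomial (Polynomial ℝ)) (j : ℕ) :
    (Dm g).coeff j = derivative (g.coeff j) := by
  unfold Dm
  rw [Polynomial.sum_def, Polynomial.finsetSum_coeff]
  simp only [coeff_C_mul, coeff_X_pow, mul_ite, mul_one, mul_zero]
  rw [Finset.sum_ite_eq]
  split_ifs with h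
  · rfl
  · rw [notMem_support_iff.mp h]; simp

lemma dMulP_eq (g : Polynomial (Polynomial ℝ)) : dMulP g = X * g + Dm g := rfl

lemma dMulP_add (g h : Polynomial (Polynomial ℝ)) : dMulP (g + h) = dMulP g + dMulP h := by
  have : Dm (g + h) = Dm g + Dm h := by
    ext1 j; simp [Dm_coeff]
  rw [dMulP_eq, dMulP_eq, dMulP_eq, this]; ring

lemma iter_add (i : ℕ) : ∀ g h : Polynomial (Polynomial ℝ),
    dMulP^[i] (g + h) = dMulP^[i] g + dMulP^[i] h := by
  induction i with
  | zero => intro g h; simp only [Function.iterate_zero, id_eq]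
  | succ i ih =>
    intro g h
    rw [Function.iterate_succ_apply, Function.iterate_succ_apply, Function.iterate_succ_apply,
      dMulP_add, ih]

/-- Truncated norm. -/
noncomputable def q (f : Polynomial (Polynomial ℝ)) (K L : ℕ) : ℝ :=
  ∑ j ∈ Finset.range K, ∑ k ∈ Finset.range L, ((f.coeff j).coeff k) ^ 2

lemma q_le (f : Polynomial (Polynomial ℝ)) (K L : ℕ) : q f K L ≤ dNormSq f := by
  have h1 : ∀ p : Polynomial ℝ, ∑ k ∈ Finset.range L, (p.coeff k) ^ 2 ≤ polyNormSq p := by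
    intro p
    unfold polyNormSq
    rw [Polynomial.sum_def, ← Finset.sum_filter_ne_zero]
    apply Finset.sum_le_sum_of_subset_of_nonneg
    · intro k hk
      rw [Finset.mem_filter] at hk
      rw [mem_support_iff]
      intro h0
      exact hk.2 (by rw [h0]; simp)
    · intro k _ _
      positivity
  have h0 : ∀ p : Polynomial ℝ, 0 ≤ polyNormSq p := by
    intro p
    unfold polyNormSq
    rw [Polynomial.sum_def]
    positivity
  refine (Finset.sum_le_sum fun j _ => h1 (f.coeff j)).trans ?_
  unfold dNormSq
  rw [Polynomial.sum_def, ← Finset.sum_filter_ne_zero]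
  apply Finset.sum_le_sum_of_subset_of_nonneg
  · intro k hk
    rw [Finset.mem_filter] at hk
    rw [mem_support_iff]
    intro h0
    exact hk.2 (by rw [h0]; simp [polyNormSq])
  · intro k _ _
    exact h0 _

lemma q_nonneg (f : Polynomial (Polynomial ℝ)) (K L : ℕ) : 0 ≤ q f K L := by
  unfold q; positivity

lemma shift_le (p : Polynomial ℝ) (L : ℕ) : ∑ k ∈ Finset.range L, ((X * p).coeff k) ^ 2 ≤
    ∑ k ∈ Finset.range L, (p.coeff k) ^ 2 := by
  rcases L with _ | L
  · simp
  · rw [Finset.sum_range_succ', Finset.sum_range_succ]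
    simp only [coeff_X_mul, coeff_X_mul_zero]
    nlinarith [sq_nonneg (p.coeff L)]

lemma shift_pow_le (p : Polynomial ℝ) (L s : ℕ) :
    ∑ k ∈ Finset.range L, ((X ^ s * p).coeff k) ^ 2 ≤
    ∑ k ∈ Finset.range L, (p.coeff k) ^ 2 := by
  induction s with
  | zero => simp
  | succ s ih =>
    rw [pow_succ', mul_assoc]
    exact (shift_le _ _).trans ih

lemma q_shift (f : Polynomial (Polynomial ℝ)) (K L : ℕ) : q (X * f) K L ≤ q f K L := by
  unfold q
  rcases K with _ | K
  · simp
  · rw [Finset.sum_range_succ', Finset.sum_range_succ]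
    simp only [coeff_X_mul, coeff_X_mul_zero]
    have : 0 ≤ ∑ k ∈ Finset.range L, ((f.coeff K).coeff k) ^ 2 := by positivity
    simpa using this

lemma q_D (f : Polynomial (Polynomial ℝ)) (d : ℕ) (hf : ∀ i, (f.coeff i).natDegree ≤ d)
    (K L : ℕ) : q (Dm f) K L ≤ (d : ℝ) ^ 2 * q f K (L + 1) := by
  unfold q
  rw [Finset.mul_sum]
  apply Finset.sum_le_sum
  intro j _
  rw [Finset.sum_range_succ', mul_add, Finset.mul_sum]
  have : ∑ k ∈ Finset.range L, (((Dm f).coeff j).coeff k) ^ 2 ≤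
      ∑ k ∈ Finset.range L, (d : ℝ) ^ 2 * ((f.coeff j).coeff (k + 1)) ^ 2 := by
    apply Finset.sum_le_sum
    intro k _
    rw [Dm_coeff, coeff_derivative, mul_pow, mul_comm]
    by_cases h : k + 1 ≤ d
    · have h' : (k : ℝ) + 1 ≤ d := by exact_mod_cast h
      gcongr
    · rw [coeff_eq_zero_of_natDegree_lt (lt_of_le_of_lt (hf j) (by omega))]
      simp
  have h2 : 0 ≤ (d : ℝ) ^ 2 * ((f.coeff j).coeff 0) ^ 2 := by positivity
  linarith

lemma q_add (u v : Polynomial (Polynomial ℝ)) (K L : ℕ) (b c N : ℝ) (hb : 0 < b) (hc : 0 < c)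
    (hu : q u K L ≤ b ^ 2 * N) (hv : q v K L ≤ c ^ 2 * N) :
    q (u + v) K L ≤ (b + c) ^ 2 * N := by
  have h : b * c * q (u + v) K L ≤ (b + c) * (c * q u K L + b * q v K L) := by
    unfold q
    simp only [Finset.mul_sum, ← Finset.sum_add_distrib]
    refine Finset.sum_le_sum fun j _ => Finset.sum_le_sum fun k _ => ?_
    simp only [coeff_add]
    nlinarith [sq_nonneg (c * (u.coeff j).coeff k - b * (v.coeff j).coeff k)]
  have h2 : (b + c) * (c * q u K L + b * q v K L) ≤
      (b + c) * (c * (b ^ 2 * N) + b * (c ^ 2 * N)) := by gcongr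
  have h3 : b * c * q (u + v) K L ≤ b * c * ((b + c) ^ 2 * N) := by
    refine (h.trans h2).trans (le_of_eq (by ring))
  exact le_of_mul_le_mul_left h3 (by positivity)

lemma iter_bound (i : ℕ) : ∀ (f : Polynomial (Polynomial ℝ)) (d : ℕ) (N : ℝ),
    (∀ i, (f.coeff i).natDegree ≤ d) → (∀ K L, q f K L ≤ N) →
    ∀ K L, q (dMulP^[i] f) K L ≤ (B i d : ℝ) ^ 2 * N := by
  induction i with
  | zero => intro f d N _ h K L; simpa [B] using h K L
  | succ i ih =>
    intro f d N hf h K L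
    have hS : ∀ j, ((X * f).coeff j).natDegree ≤ d := by
      intro j
      rcases j with _ | j
      · simp
      · rw [coeff_X_mul]; exact hf j
    have h1 := ih (X * f) d N hS (fun K L => (q_shift f K L).trans (h K L)) K L
    rw [Function.iterate_succ_apply, dMulP_eq]
    rcases Nat.eq_zero_or_pos d with rfl | hd
    · have : Dm f = 0 := by
        ext1 j
        rw [Dm_coeff, eq_C_of_natDegree_le_zero (hf j)]
        simp
      rw [this, add_zero]
      simpa [B] using h1
    · rw [iter_add]
      have hD : ∀ j, ((Dm f).coeff j).natDegree ≤ d - 1 := by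
        intro j
        rw [Dm_coeff]
        exact (natDegree_derivative_le _).trans (Nat.sub_le_sub_right (hf j) 1)
      have h2 := ih (Dm f) (d - 1) ((d : ℝ) ^ 2 * N) hD
        (fun K L => (q_D f d hf K L).trans (by gcongr; exact h _ _)) K L
      have hb : (0 : ℝ) < B i d := by exact_mod_cast B_pos i d
      have hc : (0 : ℝ) < B i (d - 1) := by exact_mod_cast B_pos i (d - 1)
      have hd' : (0 : ℝ) < d := by exact_mod_cast hd
      have := q_add _ _ K L (B i d) (d * B i (d - 1)) N hb (by positivity) h1
        (h2.trans (le_of_eq (by ring)))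
      simpa [B] using this

lemma dNormSq_nonneg (f : Polynomial (Polynomial ℝ)) : 0 ≤ dNormSq f :=
  (q_nonneg f 0 0).trans (q_le f 0 0)

lemma S_bound_real (f : Polynomial (Polynomial ℝ)) (n d μ : ℕ) (hd : 2 ≤ d)
    (hμ : 2 * n * d ≤ μ) :
    ((μ : ℝ) + 1) * ∑ i ∈ Finset.range n, (B i d : ℝ) ^ 2 * dNormSq f
      ≤ μ * ((d : ℝ) ^ (2 * n) * dNormSq f) := by
  have h : ((μ : ℝ) + 1) * (∑ i ∈ Finset.range n, (B i d : ℝ) ^ 2) ≤ μ * (d : ℝ) ^ (2 * n) := by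
    exact_mod_cast S_bound n d μ hd hμ
  rw [← Finset.sum_mul, ← mul_assoc, ← mul_assoc]
  exact mul_le_mul_of_nonneg_right h (dNormSq_nonneg f)

end InflAux

/-- Frobenius and spectral norm bounds for the inflated differential Sylvester matrix. -/
theorem inflated_sylvP_norm_bound (f g : Polynomial (Polynomial ℝ)) (m n d : ℕ)
    (hfd : f.degree ≤ (m : WithBot ℕ)) (hgd : g.degree ≤ (n : WithBot ℕ))
    (hd : 2 ≤ d)
    (hft : ∀ i, (f.coeff i).natDegree ≤ d) (hgt : ∀ i, (g.coeff i).natDegree ≤ d)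
    (μ : ℕ) (hμ : μ = 2 * (m + n) * d)
    (Vhat : Matrix (Fin (m + n) × Fin (μ + 1)) (Fin (m + n) × Fin (μ + d + 1)) ℝ)
    (hVhat : ∀ r c, Vhat r c = (X ^ (r.2 : ℕ) * sylvP f g m n r.1 c.1).coeff (c.2 : ℕ)) :
    (∑ r, ∑ c, (Vhat r c) ^ 2 ≤
        (μ : ℝ) * ((d : ℝ) ^ (2 * n) * dNormSq f + (d : ℝ) ^ (2 * m) * dNormSq g)) ∧
      ∀ x : Fin (m + n) × Fin (μ + d + 1) → ℝ,
        ∑ r, (∑ c, Vhat r c * x c) ^ 2 ≤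
          (μ : ℝ) * ((d : ℝ) ^ (2 * n) * dNormSq f + (d : ℝ) ^ (2 * m) * dNormSq g) *
            ∑ c, (x c) ^ 2 := by
  have main : ∑ r, ∑ c, (Vhat r c) ^ 2 ≤
        (μ : ℝ) * ((d : ℝ) ^ (2 * n) * dNormSq f + (d : ℝ) ^ (2 * m) * dNormSq g) := by
    let F : ℕ → Polynomial (Polynomial ℝ) := fun i =>
      if i < n then dMulP^[i] f else dMulP^[i - n] g
    let G : ℕ → ℝ := fun i => if i < n then (InflAux.B i d : ℝ) ^ 2 * dNormSq f
      else (InflAux.B (i - n) d : ℝ) ^ 2 * dNormSq g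
    have hF : ∀ i j, sylvP f g m n i j = (F i).coeff j := by
      intro i j
      simp only [sylvP, Matrix.of_apply, F]
      split_ifs <;> rfl
    have hG : ∀ i K L, InflAux.q (F i) K L ≤ G i := by
      intro i K L
      simp only [F, G]
      split_ifs
      · exact InflAux.iter_bound i f d _ hft (InflAux.q_le f) K L
      · exact InflAux.iter_bound (i - n) g d _ hgt (InflAux.q_le g) K L
    have hrow : ∀ r, ∑ c, (Vhat r c) ^ 2 ≤ G r.1 := by
      intro r
      refine le_trans ?_ (hG r.1 (m + n) (μ + d + 1))
      rw [Fintype.sum_prod_type]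
      simp only [hVhat, hF]
      unfold InflAux.q
      rw [← Fin.sum_univ_eq_sum_range
        (fun j => ∑ k ∈ Finset.range (μ + d + 1), (((F r.1).coeff j).coeff k) ^ 2)]
      apply Finset.sum_le_sum
      intro j _
      rw [Fin.sum_univ_eq_sum_range
        (fun k => ((X ^ (r.2 : ℕ) * (F r.1).coeff j : Polynomial ℝ).coeff k) ^ 2)]
      exact InflAux.shift_pow_le _ _ _
    calc ∑ r, ∑ c, (Vhat r c) ^ 2 ≤ ∑ r : Fin (m + n) × Fin (μ + 1), G r.1 :=
          Finset.sum_le_sum fun r _ => hrow r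
      _ = ((μ : ℝ) + 1) * ∑ i ∈ Finset.range (n + m), G i := by
          rw [Fintype.sum_prod_type]
          simp only [Finset.sum_const, Finset.card_univ, Fintype.card_fin, nsmul_eq_mul]
          rw [← Finset.mul_sum, Fin.sum_univ_eq_sum_range G, add_comm m n]
          push_cast
          rfl
      _ = ((μ : ℝ) + 1) * ∑ i ∈ Finset.range n, (InflAux.B i d : ℝ) ^ 2 * dNormSq f +
          ((μ : ℝ) + 1) * ∑ i ∈ Finset.range m, (InflAux.B i d : ℝ) ^ 2 * dNormSq g := by
          rw [Finset.sum_range_add, mul_add]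
          congr 2
          · apply Finset.sum_congr rfl
            intro i hi
            simp only [G, if_pos (Finset.mem_range.mp hi)]
          · apply Finset.sum_congr rfl
            intro i hi
            simp [G]
      _ ≤ _ := by
          rw [mul_add]
          apply add_le_add
          · apply InflAux.S_bound_real f n d μ hd
            rw [hμ]; gcongr; omega
          · apply InflAux.S_bound_real g m d μ hd
            rw [hμ]; gcongr; omega
  refine ⟨main, fun x => ?_⟩
  calc ∑ r, (∑ c, Vhat r c * x c) ^ 2 ≤ ∑ r, (∑ c, (Vhat r c) ^ 2) * ∑ c, (x c) ^ 2 :=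
        Finset.sum_le_sum fun r _ => Finset.sum_mul_sq_le_sq_mul_sq _ _ _
    _ = (∑ r, ∑ c, (Vhat r c) ^ 2) * ∑ c, (x c) ^ 2 := by rw [Finset.sum_mul]
    _ ≤ _ := by gcongr
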